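/- arXiv:1512.03246 — 2 statements merged into one kernel-verified Lean document; each statement's English description precedes it below -/
import Mathlib

section
/- Let G = (V₀ ⊎ V₁, E, p) be a bipartite parity game, and let u, v ∈ V₀ be distinct nodes with N⁺_G(u) = N⁺_G(v) and p(u) = p(v). Let G' be the parity game obtained from G by contracting u and v into a new node v' with priority p(v). Then u and v belong to the winning set win_i(G) of the same player i in G, the node v' belongs to the winning set win_i(G') of that same player i in G', and for all other nodes the winning sets of G and G' coincide. -/
universe u

/-- A parity game on an ambient vertex type `V`: a finite set of nodes, an owner
(player `0` or `1`) for each node, a directed edge relation between nodes, and a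
priority function. -/
structure ParityGame (V : Type u) where
  nodes : Set V
  finite : nodes.Finite
  owner : V → Fin 2
  edge : V → V → Prop
  edge_mem : ∀ u v, edge u v → u ∈ nodes ∧ v ∈ nodes
  priority : V → ℕ

namespace ParityGame

variable {V : Type u}

/-- Every node has at least one outgoing edge. -/
def Proper (G : ParityGame V) : Prop := ∀ u ∈ G.nodes, ∃ v, G.edge u v

/-- The game is bipartite: every edge goes between nodes of the two different players. -/
def Bipartite (G : ParityGame V) : Prop := ∀ u v, G.edge u v → G.owner u ≠ G.owner v

/-- The opponent `¬i = 1 - i` of player `i`. -/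
def other (i : Fin 2) : Fin 2 := 1 - i

/-- The set `V_i` of nodes owned by player `i`. -/
def playerNodes (G : ParityGame V) (i : Fin 2) : Set V := {v | v ∈ G.nodes ∧ G.owner v = i}

/-- An infinite play: consecutive positions are joined by edges. -/
def IsPlay (G : ParityGame V) (f : ℕ → V) : Prop := ∀ n, G.edge (f n) (f (n + 1))

/-- A (history-dependent) strategy: given the history of previously visited nodes and
the current node, it returns the next node. -/
def Strategy (V : Type u) := List V → V → V

/-- A strategy for player `i` is valid if at every node owned by player `i` it chooses
an outgoing edge. -/
def ValidStrategy (G : ParityGame V) (i : Fin 2) (σ : Strategy V) : Prop :=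
  ∀ (h : List V) (u : V), u ∈ G.nodes → G.owner u = i → G.edge u (σ h u)

/-- The play `f` is consistent with the strategy `σ` of player `i`. -/
def Consistent (G : ParityGame V) (i : Fin 2) (σ : Strategy V) (f : ℕ → V) : Prop :=
  ∀ n, G.owner (f n) = i → f (n + 1) = σ (List.ofFn fun k : Fin n => f k.1) (f n)

/-- `P` holds infinitely often. -/
def InfOften (P : ℕ → Prop) : Prop := ∀ N, ∃ n, N ≤ n ∧ P n

/-- Player `i` wins the play `f` if the largest priority occurring infinitely often
on `f` has parity `i`. -/
def WinsPlay (G : ParityGame V) (i : Fin 2) (f : ℕ → V) : Prop :=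
  ∃ q, InfOften (fun n => G.priority (f n) = q) ∧
    (∀ q', InfOften (fun n => G.priority (f n) = q') → q' ≤ q) ∧ q % 2 = i.1

/-- Player `i` has a winning strategy from node `v`. -/
def WinsFrom (G : ParityGame V) (i : Fin 2) (v : V) : Prop :=
  ∃ σ : Strategy V, ValidStrategy G i σ ∧
    ∀ f : ℕ → V, f 0 = v → IsPlay G f → Consistent G i σ f → WinsPlay G i f

/-- The winning set of player `i`. -/
def winSet (G : ParityGame V) (i : Fin 2) : Set V := {v | v ∈ G.nodes ∧ WinsFrom G i v}

/-- A set `B` of nodes is `i`-closed: player `i` can stay inside `B` and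
player `¬i` cannot leave `B`. -/
def IClosed (G : ParityGame V) (i : Fin 2) (B : Set V) : Prop :=
  B ⊆ G.nodes ∧ ∀ u ∈ B,
    (G.owner u = i → ∃ w, G.edge u w ∧ w ∈ B) ∧
    (G.owner u = other i → ∀ w, G.edge u w → w ∈ B)

/-- The `i`-reachability set of `A`: the set `A` together with all nodes from which
player `i` has a strategy guaranteeing that the play enters `A` at least once. -/
def reach (G : ParityGame V) (i : Fin 2) (A : Set V) : Set V :=
  A ∪ {v | v ∈ G.nodes ∧ ∃ σ : Strategy V, ValidStrategy G i σ ∧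
        ∀ f : ℕ → V, f 0 = v → IsPlay G f → Consistent G i σ f → ∃ n, f n ∈ A}

/-- An `i`-dominion: a set of nodes from each of which player `i` can win
without the play ever leaving the set. -/
def IsDominion (G : ParityGame V) (i : Fin 2) (D : Set V) : Prop :=
  D ⊆ G.nodes ∧ ∃ σ : Strategy V, ValidStrategy G i σ ∧
    ∀ v ∈ D, ∀ f : ℕ → V, f 0 = v → IsPlay G f → Consistent G i σ f →
      WinsPlay G i f ∧ ∀ n, f n ∈ D

/-- The sub-game `G − B` obtained by removing the nodes of `B`. -/
def sub (G : ParityGame V) (B : Set V) : ParityGame V where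
  nodes := G.nodes \ B
  finite := G.finite.subset Set.diff_subset
  owner := G.owner
  edge u v := G.edge u v ∧ u ∉ B ∧ v ∉ B
  edge_mem := fun u v h =>
    ⟨⟨(G.edge_mem u v h.1).1, h.2.1⟩, ⟨(G.edge_mem u v h.1).2, h.2.2⟩⟩
  priority := G.priority

/-- The signed priority `p₁`: `p(v)` if `p(v)` is odd, `−p(v)` if `p(v)` is even. -/
def p1 (G : ParityGame V) (v : V) : ℤ :=
  if G.priority v % 2 = 1 then (G.priority v : ℤ) else -(G.priority v : ℤ)

end ParityGame

namespace ParityGame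

variable {V : Type u}

theorem IsPlay.mem_nodes {G : ParityGame V} {f : ℕ → V} (hf : G.IsPlay f) (n : ℕ) :
    f n ∈ G.nodes :=
  (G.edge_mem _ _ (hf n)).1

/-! ### Transfer of strategies along a functional bisimulation -/

theorem winsFrom_of_map {G G' : ParityGame V} (π : V → V)
    (hmem : ∀ x ∈ G.nodes, π x ∈ G'.nodes)
    (howner : ∀ x ∈ G.nodes, G'.owner (π x) = G.owner x)
    (hprio : ∀ x ∈ G.nodes, G'.priority (π x) = G.priority x)
    (hforth : ∀ x y, G.edge x y → G'.edge (π x) (π y))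
    (hback : ∀ x ∈ G.nodes, ∀ y', G'.edge (π x) y' → ∃ y, G.edge x y ∧ π y = y')
    {i : Fin 2} {w : V} (h : G'.WinsFrom i (π w)) : G.WinsFrom i w := by
  classical
  obtain ⟨σ', hσ', hwin⟩ := h
  have hlift : ∀ (l : List V) (x : V), x ∈ G.nodes → G.owner x = i →
      ∃ y, G.edge x y ∧ π y = σ' (l.map π) (π x) := fun l x hx ho =>
    hback x hx _ (hσ' _ _ (hmem x hx) ((howner x hx).trans ho))
  let σ : Strategy V := fun l x =>
    if hy : ∃ y, G.edge x y ∧ π y = σ' (l.map π) (π x) then hy.choose else x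
  have hσ : ∀ (l : List V) (x : V), x ∈ G.nodes → G.owner x = i →
      G.edge x (σ l x) ∧ π (σ l x) = σ' (l.map π) (π x) := by
    intro l x hx ho
    have hy := hlift l x hx ho
    simp only [σ, dif_pos hy]
    exact hy.choose_spec
  refine ⟨σ, fun l x hx ho => (hσ l x hx ho).1, fun f hf0 hf hcons => ?_⟩
  have hp : ∀ n, G'.priority (π (f n)) = G.priority (f n) := fun n => hprio _ (hf.mem_nodes n)
  have := hwin (fun n => π (f n)) (congrArg π hf0) (fun n => hforth _ _ (hf n)) (by
    intro n hn
    rw [howner _ (hf.mem_nodes n)] at hn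
    have h1 := hcons n hn
    have h2 := (hσ (List.ofFn fun k : Fin n => f k.1) (f n) (hf.mem_nodes n) hn).2
    rw [← h1, List.map_ofFn] at h2
    exact h2)
  simpa only [WinsPlay, hp] using this

/-! ### No node is won by both players -/

theorem WinsPlay.unique {G : ParityGame V} {i j : Fin 2} {f : ℕ → V}
    (hi : G.WinsPlay i f) (hj : G.WinsPlay j f) : i = j := by
  obtain ⟨q, hq, hq_max, hqi⟩ := hi
  obtain ⟨r, hr, hr_max, hrj⟩ := hj
  have : q = r := le_antisymm (hr_max q hq) (hq_max r hr)
  subst this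
  exact Fin.ext (hqi.symm.trans hrj)

theorem winsFrom_unique {G : ParityGame V} {i j : Fin 2} {w : V} (hw : w ∈ G.nodes)
    (hi : G.WinsFrom i w) (hj : G.WinsFrom j w) : i = j := by
  classical
  by_contra hij
  obtain ⟨σ, hσ, hσw⟩ := hi
  obtain ⟨τ, hτ, hτw⟩ := hj
  let next : List V → V → V := fun l x => if G.owner x = i then σ l x else τ l x
  let s : ℕ → List V × V := fun n =>
    Nat.rec ([], w) (fun _ p => (p.1 ++ [p.2], next p.1 p.2)) n
  have hs : ∀ n, s (n + 1) = ((s n).1 ++ [(s n).2], next (s n).1 (s n).2) := fun _ => rfl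
  have hh : ∀ n, (s n).1 = List.ofFn fun k : Fin n => (s k.1).2 := by
    intro n
    induction n with
    | zero => rfl
    | succ n ih =>
      rw [hs, List.ofFn_succ', List.concat_eq_append]
      simp only [Fin.val_castSucc, Fin.val_last, ← ih]
  have hoj : ∀ x, G.owner x ≠ i → G.owner x = j := by
    intro x hx
    omega
  have hnext : ∀ l x, x ∈ G.nodes → G.edge x (next l x) := by
    intro l x hx
    by_cases ho : G.owner x = i
    · simpa only [next, if_pos ho] using hσ l x hx ho
    · simpa only [next, if_neg ho] using hτ l x hx (hoj x ho)
  have hmem : ∀ n, (s n).2 ∈ G.nodes := by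
    intro n
    induction n with
    | zero => exact hw
    | succ n ih => exact (G.edge_mem _ _ (hnext (s n).1 _ ih)).2
  have hplay : G.IsPlay fun n => (s n).2 := fun n => hnext (s n).1 _ (hmem n)
  refine hij (WinsPlay.unique (hσw _ rfl hplay fun n hn => ?_) (hτw _ rfl hplay fun n hn => ?_))
  · rw [← hh]
    exact if_pos hn
  · rw [← hh]
    exact if_neg fun h => hij (h.symm.trans hn)

/-! ### Determinacy

The stack of a history is the simple path left after deleting every cycle as soon as it is
closed. In the first-cycle game the play stops when a cycle is closed, and the parity of its
largest priority decides the winner. This finite game is determined, and a player who wins it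
wins the parity game by following the stack. -/

/-- Player `i` likes the largest priority in `R`. -/
def GoodCycle (G : ParityGame V) (i : Fin 2) (R : List V) : Prop :=
  ∃ z ∈ R, G.priority z % 2 = i.1 ∧ ∀ w ∈ R, G.priority w ≤ G.priority z

theorem goodCycle_or {G : ParityGame V} {i j : Fin 2} (hij : i ≠ j) {R : List V} (hR : R ≠ []) :
    G.GoodCycle i R ∨ G.GoodCycle j R := by
  classical
  obtain ⟨z, hz, hmax⟩ := R.toFinset.exists_max_image G.priority
    (List.toFinset_nonempty_iff R |>.2 hR)
  simp only [List.mem_toFinset] at hz hmax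
  have : G.priority z % 2 = i.1 ∨ G.priority z % 2 = j.1 := by omega
  exact this.imp (fun h => ⟨z, hz, h, hmax⟩) (fun h => ⟨z, hz, h, hmax⟩)

open Classical in
/-- The part of the stack `S` (current node first) above the topmost occurrence of `y`. -/
noncomputable def above (S : List V) (y : V) : List V := S.takeWhile (fun x => decide (x ≠ y))

open Classical in
/-- The stack after moving to `y`, where a closed cycle is removed. -/
noncomputable def stackStep (S : List V) (y : V) : List V :=
  if y ∈ S then S.dropWhile (fun x => decide (x ≠ y)) else y :: S

theorem stackStep_of_notMem {S : List V} {y : V} (h : y ∉ S) : stackStep S y = y :: S :=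
  if_neg h

theorem above_append_stackStep {S : List V} {y : V} (h : y ∈ S) :
    above S y ++ stackStep S y = S := by
  rw [above, stackStep, if_pos h, List.takeWhile_append_dropWhile]

theorem exists_stackStep_eq_cons (S : List V) (y : V) : ∃ T, stackStep S y = y :: T := by
  classical
  by_cases h : y ∈ S
  · rw [stackStep, if_pos h]
    induction S with
    | nil => simp at h
    | cons x S ih =>
      by_cases hx : x = y
      · exact ⟨S, by simp [hx]⟩
      · simpa [hx] using ih ((List.mem_cons.1 h).resolve_left (Ne.symm hx))
  · exact ⟨S, stackStep_of_notMem h⟩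

/-- Player `i` wins the first-cycle game from the stack `S`. -/
inductive CycleWin (G : ParityGame V) (i : Fin 2) : List V → Prop
  | own (x : V) (T : List V) (y : V) : G.owner x = i → G.edge x y →
      (y ∈ x :: T → G.GoodCycle i (above (x :: T) y ++ [y])) →
      (y ∉ x :: T → CycleWin G i (y :: x :: T)) → CycleWin G i (x :: T)
  | opp (x : V) (T : List V) : G.owner x ≠ i →
      (∀ y, G.edge x y → y ∈ x :: T → G.GoodCycle i (above (x :: T) y ++ [y])) →
      (∀ y, G.edge x y → y ∉ x :: T → CycleWin G i (y :: x :: T)) → CycleWin G i (x :: T)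

/-- Moving from the stack `S` to `y` is good for player `i` in the first-cycle game. -/
def MoveOk (G : ParityGame V) (i : Fin 2) (S : List V) (y : V) : Prop :=
  (y ∈ S → G.GoodCycle i (above S y ++ [y])) ∧ (y ∉ S → G.CycleWin i (y :: S))

theorem length_le_ncard {G : ParityGame V} {S : List V} (hS : S.Nodup)
    (hSG : ∀ x ∈ S, x ∈ G.nodes) : S.length ≤ G.nodes.ncard := by
  classical
  rw [← List.toFinset_card_of_nodup hS, ← Set.ncard_coe_finset]
  exact Set.ncard_le_ncard (fun x hx => hSG x (by simpa using hx)) G.finite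

theorem cycleWin_or {G : ParityGame V} {i j : Fin 2} (hij : i ≠ j) (x : V) (T : List V)
    (hS : (x :: T).Nodup) (hSG : ∀ z ∈ x :: T, z ∈ G.nodes) :
    G.CycleWin i (x :: T) ∨ G.CycleWin j (x :: T) := by
  induction hk : G.nodes.ncard - (x :: T).length using Nat.strong_induction_on
    generalizing i j x T with
  | _ k ih =>
    wlog ho : G.owner x = i generalizing i j
    · exact (this (i := j) (j := i) hij.symm (by omega)).symm
    by_cases hex : ∃ y, G.edge x y ∧ G.MoveOk i (x :: T) y
    · obtain ⟨y, hy, hok⟩ := hex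
      exact Or.inl (.own x T y ho hy hok.1 hok.2)
    · right
      refine .opp x T (fun h => hij (ho.symm.trans h)) (fun y hy hmem => ?_) (fun y hy hmem => ?_)
      · exact (goodCycle_or hij (by simp)).resolve_left
          fun h => hex ⟨y, hy, fun _ => h, fun h' => absurd hmem h'⟩
      · have hS' : (y :: x :: T).Nodup := List.nodup_cons.2 ⟨hmem, hS⟩
        have hSG' : ∀ z ∈ y :: x :: T, z ∈ G.nodes :=
          List.forall_mem_cons.2 ⟨(G.edge_mem _ _ hy).2, hSG⟩
        have hlen := length_le_ncard hS' hSG'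
        refine (ih _ ?_ hij y (x :: T) hS' hSG' rfl).resolve_left
          fun h => hex ⟨y, hy, fun h' => absurd h' hmem, fun _ => h⟩
        simp only [List.length_cons] at hlen hk ⊢
        omega

theorem CycleWin.exists_moveOk {G : ParityGame V} {i : Fin 2} {x : V} {T : List V}
    (h : G.CycleWin i (x :: T)) (ho : G.owner x = i) :
    ∃ y, G.edge x y ∧ G.MoveOk i (x :: T) y := by
  cases h with
  | own _ _ y _ hy h1 h2 => exact ⟨y, hy, h1, h2⟩
  | opp _ _ h => exact absurd ho h

theorem CycleWin.moveOk {G : ParityGame V} {i : Fin 2} {x y : V} {T : List V}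
    (h : G.CycleWin i (x :: T)) (ho : G.owner x ≠ i) (hy : G.edge x y) :
    G.MoveOk i (x :: T) y := by
  cases h with
  | own _ _ _ h => exact absurd h ho
  | opp _ _ _ h1 h2 => exact ⟨h1 y hy, h2 y hy⟩

theorem exists_eventually_const {a : ℕ → ℕ} {M : ℕ} (ha : ∀ n, M ≤ n → a (n + 1) ≤ a n) :
    ∃ K, M ≤ K ∧ ∀ n, K ≤ n → a n = a K := by
  obtain ⟨K, hK, hmin⟩ : ∃ K, M ≤ K ∧ ∀ n, M ≤ n → a K ≤ a n := by
    obtain ⟨K, hK, h⟩ := (measure a).wf.has_min {n | M ≤ n} ⟨M, le_refl M⟩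
    exact ⟨K, hK, fun n hn => not_lt.1 (h n hn)⟩
  refine ⟨K, hK, fun n hn => ?_⟩
  induction n, hn using Nat.le_induction with
  | base => rfl
  | succ n hn ih =>
    exact le_antisymm ((ha n (hK.trans hn)).trans ih.le) (hmin _ (by omega))

theorem not_infOften_increase {b : ℕ → ℕ} {C M : ℕ} (hC : ∀ n, b n ≤ C)
    (hb : ∀ n, M ≤ n → b n ≤ b (n + 1)) : ¬ InfOften fun n => b n < b (n + 1) := by
  intro h
  obtain ⟨K, hK, hconst⟩ := exists_eventually_const (a := fun n => C - b n) (M := M)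
    fun n hn => Nat.sub_le_sub_left (hb n hn) C
  obtain ⟨n, hn, hlt⟩ := h K
  have h1 := hconst n hn
  have h2 := hconst (n + 1) (by omega)
  have h3 := hC n
  have h4 := hC (n + 1)
  omega

theorem exists_max_infOften {p : ℕ → ℕ} {B : ℕ} (hB : ∀ n, p n ≤ B) :
    ∃ q, InfOften (fun n => p n = q) ∧ (∀ q', InfOften (fun n => p n = q') → q' ≤ q) ∧
      ∃ M, ∀ n, M ≤ n → p n ≤ q := by
  classical
  have hP0 : InfOften fun n => 0 ≤ p n := fun N => ⟨N, le_rfl, Nat.zero_le _⟩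
  have hle : ∀ m, InfOften (fun n => m ≤ p n) → m ≤ B := fun m hm => by
    obtain ⟨n, -, hn⟩ := hm 0
    exact hn.trans (hB n)
  have hq : InfOften fun n => Nat.findGreatest (fun m => InfOften fun n => m ≤ p n) B ≤ p n :=
    Nat.findGreatest_spec (P := fun m => InfOften fun n => m ≤ p n) (Nat.zero_le B) hP0
  have hmax : ∀ m, InfOften (fun n => m ≤ p n) →
      m ≤ Nat.findGreatest (fun m => InfOften fun n => m ≤ p n) B :=
    fun m hm => Nat.le_findGreatest (hle m hm) hm
  generalize Nat.findGreatest (fun m => InfOften fun n => m ≤ p n) B = q at hq hmax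
  have hM : ∃ M, ∀ n, M ≤ n → p n ≤ q := by
    by_contra! hcon
    have := hmax (q + 1) fun N => hcon N
    omega
  refine ⟨q, fun N => ?_, fun q' hq' => hmax q' fun N => ?_, hM⟩
  · obtain ⟨M, hM⟩ := hM
    obtain ⟨n, hn, hqn⟩ := hq (max N M)
    exact ⟨n, (le_max_left _ _).trans hn, le_antisymm (hM n ((le_max_right _ _).trans hn)) hqn⟩
  · obtain ⟨n, hn, h⟩ := hq' N
    exact ⟨n, hn, h.ge⟩

/-- A play whose stacks only lose cycles that player `i` likes is won by player `i`. -/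
theorem winsPlay_of_goodCycles {G : ParityGame V} {i : Fin 2} {f : ℕ → V} {S : ℕ → List V}
    (hf : ∀ n, f n ∈ G.nodes) (hstep : ∀ n, S (n + 1) = stackStep (S n) (f (n + 1)))
    (hlen : ∀ n, (S n).length ≤ G.nodes.ncard)
    (hgood : ∀ n, f (n + 1) ∈ S n → G.GoodCycle i (above (S n) (f (n + 1)) ++ [f (n + 1)])) :
    G.WinsPlay i f := by
  obtain ⟨B, hB⟩ := (G.finite.image G.priority).bddAbove
  obtain ⟨q, hq, hmax, M, hM⟩ := exists_max_infOften (p := fun n => G.priority (f n)) (B := B)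
    fun n => hB ⟨f n, hf n, rfl⟩
  refine ⟨q, hq, hmax, ?_⟩
  by_contra hqi
  let a : ℕ → ℕ := fun n => (S n).countP fun x => decide (q < G.priority x)
  let b : ℕ → ℕ := fun n => (S n).countP fun x => decide (G.priority x = q)
  have hsplit : ∀ (P : V → Bool) n, f (n + 1) ∈ S n →
      (S n).countP P = (above (S n) (f (n + 1))).countP P + (S (n + 1)).countP P := by
    intro P n hmem
    rw [hstep, ← List.countP_append, above_append_stackStep hmem]
  obtain ⟨K, hK, hconst⟩ := exists_eventually_const (a := a) (M := M) (by
    intro n hn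
    by_cases hmem : f (n + 1) ∈ S n
    · have := hsplit (fun x => decide (q < G.priority x)) n hmem
      simp only [a]
      omega
    · have := hM (n + 1) (by omega)
      simp only [a, hstep, stackStep_of_notMem hmem]
      rw [List.countP_cons_of_neg (by simpa using this)])
  have hlow : ∀ n, K ≤ n → f (n + 1) ∈ S n →
      ∀ x ∈ above (S n) (f (n + 1)) ++ [f (n + 1)], G.priority x < q := by
    intro n hn hmem
    have h0 : (above (S n) (f (n + 1))).countP (fun x => decide (q < G.priority x)) = 0 := by
      have h1 := hsplit (fun x => decide (q < G.priority x)) n hmem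
      have h2 := (hconst n hn).trans (hconst (n + 1) (by omega)).symm
      simp only [a] at h2
      omega
    have hle : ∀ x ∈ above (S n) (f (n + 1)) ++ [f (n + 1)], G.priority x ≤ q := by
      intro x hx
      rcases List.mem_append.1 hx with hx | hx
      · simpa using List.countP_eq_zero.1 h0 x hx
      · rw [List.mem_singleton.1 hx]
        exact hM (n + 1) (by omega)
    obtain ⟨z, hz, hzi, hzmax⟩ := hgood n hmem
    have hzq : G.priority z ≠ q := fun h => hqi (h ▸ hzi)
    exact fun x hx => (hzmax x hx).trans_lt (lt_of_le_of_ne (hle z hz) hzq)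
  refine not_infOften_increase (b := b) (M := K)
    (fun n => List.countP_le_length.trans (hlen n)) (fun n hn => ?_) (fun N => ?_)
  · by_cases hmem : f (n + 1) ∈ S n
    · have h1 := hsplit (fun x => decide (G.priority x = q)) n hmem
      have h0 : (above (S n) (f (n + 1))).countP (fun x => decide (G.priority x = q)) = 0 :=
        List.countP_eq_zero.2 fun x hx => by
          simpa using (hlow n hn hmem x (List.mem_append_left _ hx)).ne
      simp only [b]
      omega
    · simp only [b, hstep, stackStep_of_notMem hmem, List.countP_cons]
      omega
  · obtain ⟨n, hn, hqn⟩ := hq (max N K + 1)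
    obtain ⟨n, rfl⟩ : ∃ m, n = m + 1 := ⟨n - 1, by omega⟩
    have hNK : max N K ≤ n := by omega
    refine ⟨n, (le_max_left _ _).trans hNK, ?_⟩
    have hmem : f (n + 1) ∉ S n := fun hmem =>
      (hlow n ((le_max_right _ _).trans hNK) hmem (f (n + 1)) (by simp)).ne hqn
    simp only [b, hstep, stackStep_of_notMem hmem, List.countP_cons, hqn]
    simp

theorem winsFrom_of_cycleWin {G : ParityGame V} (hG : G.Proper) {i : Fin 2} {w : V}
    (hw : G.CycleWin i [w]) : G.WinsFrom i w := by
  classical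
  let stack : List V → V → List V := fun l x => (l ++ [x]).foldl stackStep []
  have hmove : ∀ l x, x ∈ G.nodes → ∃ y, G.edge x y ∧
      ((∃ z, G.edge x z ∧ G.MoveOk i (stack l x) z) → G.MoveOk i (stack l x) y) := by
    intro l x hx
    by_cases h : ∃ z, G.edge x z ∧ G.MoveOk i (stack l x) z
    · exact h.imp fun z hz => ⟨hz.1, fun _ => hz.2⟩
    · exact (hG x hx).imp fun z hz => ⟨hz, fun h' => absurd h' h⟩
  let σ : Strategy V := fun l x => if hx : x ∈ G.nodes then (hmove l x hx).choose else x
  have hσ : ∀ l x, x ∈ G.nodes → G.edge x (σ l x) ∧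
      ((∃ z, G.edge x z ∧ G.MoveOk i (stack l x) z) → G.MoveOk i (stack l x) (σ l x)) := by
    intro l x hx
    simp only [σ, dif_pos hx]
    exact (hmove l x hx).choose_spec
  refine ⟨σ, fun l x hx _ => (hσ l x hx).1, fun f hf0 hf hcons => ?_⟩
  let S : ℕ → List V := fun n => stack (List.ofFn fun k : Fin n => f k.1) (f n)
  have hS0 : S 0 = [w] := by
    simp [S, stack, stackStep, hf0]
  have hstep : ∀ n, S (n + 1) = stackStep (S n) (f (n + 1)) := by
    intro n
    simp only [S, stack]
    rw [List.foldl_append, List.ofFn_succ', List.concat_eq_append]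
    rfl
  have hhead : ∀ n, ∃ T, S n = f n :: T := by
    intro n
    cases n with
    | zero => exact ⟨[], by rw [hS0, hf0]⟩
    | succ n => rw [hstep]; exact exists_stackStep_eq_cons _ _
  have hok : ∀ n, G.CycleWin i (S n) → G.MoveOk i (S n) (f (n + 1)) := by
    intro n hn
    by_cases ho : G.owner (f n) = i
    · have h := (hσ (List.ofFn fun k : Fin n => f k.1) (f n) (hf.mem_nodes n)).2
      rw [← hcons n ho] at h
      refine h ?_
      change ∃ z, G.edge (f n) z ∧ G.MoveOk i (S n) z
      obtain ⟨T, hT⟩ := hhead n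
      rw [hT] at hn ⊢
      exact hn.exists_moveOk ho
    · obtain ⟨T, hT⟩ := hhead n
      rw [hT] at hn ⊢
      exact hn.moveOk ho (hf n)
  have hinv : ∀ n, (S n).Nodup ∧ (∀ x ∈ S n, x ∈ G.nodes) ∧
      ∀ T, T ≠ [] → T <:+ S n → G.CycleWin i T := by
    intro n
    induction n with
    | zero =>
      rw [hS0]
      refine ⟨List.nodup_singleton w, ?_, fun T hT hTS => ?_⟩
      · simpa [hf0] using hf.mem_nodes 0
      · rcases List.suffix_cons_iff.1 hTS with rfl | h
        · exact hw
        · exact absurd (List.suffix_nil.1 h) hT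
    | succ n ih =>
      obtain ⟨hnd, hnodes, hsuf⟩ := ih
      have hne : S n ≠ [] := by
        obtain ⟨T, hT⟩ := hhead n
        simp [hT]
      rw [hstep]
      by_cases hmem : f (n + 1) ∈ S n
      · have hs : stackStep (S n) (f (n + 1)) <:+ S n := ⟨_, above_append_stackStep hmem⟩
        exact ⟨hnd.sublist hs.sublist, fun x hx => hnodes x (hs.subset hx),
          fun T hT hTS => hsuf T hT (hTS.trans hs)⟩
      · rw [stackStep_of_notMem hmem]
        refine ⟨List.nodup_cons.2 ⟨hmem, hnd⟩,
          List.forall_mem_cons.2 ⟨hf.mem_nodes _, hnodes⟩, fun T hT hTS => ?_⟩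
        rcases List.suffix_cons_iff.1 hTS with rfl | h
        · exact (hok n (hsuf _ hne List.suffix_rfl)).2 hmem
        · exact hsuf T hT h
  refine winsPlay_of_goodCycles hf.mem_nodes hstep
    (fun n => length_le_ncard (hinv n).1 (hinv n).2.1) (fun n => (hok n ?_).1)
  obtain ⟨T, hT⟩ := hhead n
  exact (hinv n).2.2 _ (by simp [hT]) List.suffix_rfl

/-- Parity games are determined. -/
theorem Proper.exists_winsFrom {G : ParityGame V} (hG : G.Proper) {w : V} (hw : w ∈ G.nodes) :
    ∃ i, G.WinsFrom i w := by
  rcases cycleWin_or (G := G) (i := 0) (j := 1) (by decide) w [] (List.nodup_singleton w)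
    (by simpa using hw) with h | h
  · exact ⟨0, winsFrom_of_cycleWin hG h⟩
  · exact ⟨1, winsFrom_of_cycleWin hG h⟩

end ParityGame

/-- In a bipartite parity game, contracting two distinct nodes
`u, v ∈ V₀` with `N⁺(u) = N⁺(v)` and `p(u) = p(v)` into a fresh node `v'` preserves
the winner: `u`, `v` and `v'` are won by the same player, and the winning sets of
all other nodes coincide. -/
theorem contraction {V : Type} (G G' : ParityGame V) (hG : G.Proper) (hbip : G.Bipartite)
    (u v v' : V) (hu : u ∈ G.nodes) (hv : v ∈ G.nodes) (huv : u ≠ v)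
    (hou : G.owner u = 0) (hov : G.owner v = 0)
    (hN : ∀ w, G.edge u w ↔ G.edge v w) (hpuv : G.priority u = G.priority v)
    (hfresh : v' ∉ G.nodes)
    (hnodes : G'.nodes = (G.nodes \ {u, v}) ∪ {v'})
    (howner : ∀ w ∈ G.nodes \ ({u, v} : Set V), G'.owner w = G.owner w)
    (hov' : G'.owner v' = 0)
    (hprio : ∀ w ∈ G.nodes \ ({u, v} : Set V), G'.priority w = G.priority w)
    (hpv' : G'.priority v' = G.priority v)
    (hedge : ∀ a b, a ∉ ({u, v, v'} : Set V) → b ∉ ({u, v, v'} : Set V) →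
      (G'.edge a b ↔ G.edge a b))
    (hedgeIn : ∀ a, a ∉ ({u, v} : Set V) → (G'.edge a v' ↔ (G.edge a u ∨ G.edge a v)))
    (hedgeOut : ∀ b, b ∉ ({u, v} : Set V) → (G'.edge v' b ↔ G.edge u b)) :
    (∃ i : Fin 2, u ∈ G.winSet i ∧ v ∈ G.winSet i ∧ v' ∈ G'.winSet i) ∧
      (∀ w ∈ G.nodes \ ({u, v} : Set V), ∀ i : Fin 2,
        (w ∈ G.winSet i ↔ w ∈ G'.winSet i)) := by
  classical
  have hv'u : v' ≠ u := fun h => hfresh (h ▸ hu)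
  have hv'v : v' ≠ v := fun h => hfresh (h ▸ hv)
  have hne' : ∀ x ∈ G.nodes, x ≠ v' := fun x hx h => hfresh (h ▸ hx)
  have hout : ∀ y, G.edge u y → y ∉ ({u, v} : Set V) := by
    rintro y hy (rfl | rfl)
    · exact hbip _ _ hy rfl
    · exact hbip _ _ hy (hou.trans hov.symm)
  let π : V → V := fun x => if x ∈ ({u, v} : Set V) then v' else x
  have hπ1 : ∀ x, x ∈ ({u, v} : Set V) → π x = v' := fun x hx => if_pos hx
  have hπ2 : ∀ x, x ∉ ({u, v} : Set V) → π x = x := fun x hx => if_neg hx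
  have hedge_uv : ∀ x ∈ ({u, v} : Set V), ∀ y, G.edge x y ↔ G.edge u y := by
    rintro x (rfl | rfl) y
    · exact Iff.rfl
    · exact (hN y).symm
  have hnot : ∀ x, x ∉ ({u, v} : Set V) → x ≠ v' → x ∉ ({u, v, v'} : Set V) := by
    rintro x hx hx' (h | h | h)
    · exact hx (Or.inl h)
    · exact hx (Or.inr h)
    · exact hx' h
  have hG'mem : ∀ x ∈ G'.nodes, x ∉ ({u, v} : Set V) := by
    rw [hnodes]
    rintro x (hx | rfl)
    · exact hx.2
    · rintro (h | h)
      · exact hv'u h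
      · exact hv'v h
  have hmem : ∀ x ∈ G.nodes, π x ∈ G'.nodes := by
    intro x hx
    rw [hnodes]
    by_cases hxu : x ∈ ({u, v} : Set V)
    · exact Or.inr (hπ1 x hxu)
    · exact Or.inl (by rw [hπ2 x hxu]; exact ⟨hx, hxu⟩)
  have hown : ∀ x ∈ G.nodes, G'.owner (π x) = G.owner x := by
    intro x hx
    by_cases hxu : x ∈ ({u, v} : Set V)
    · rw [hπ1 x hxu, hov']
      rcases hxu with rfl | rfl
      · exact hou.symm
      · exact hov.symm
    · rw [hπ2 x hxu]
      exact howner x ⟨hx, hxu⟩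
  have hpri : ∀ x ∈ G.nodes, G'.priority (π x) = G.priority x := by
    intro x hx
    by_cases hxu : x ∈ ({u, v} : Set V)
    · rw [hπ1 x hxu, hpv']
      rcases hxu with rfl | rfl
      · exact hpuv.symm
      · rfl
    · rw [hπ2 x hxu]
      exact hprio x ⟨hx, hxu⟩
  have hforth : ∀ x y, G.edge x y → G'.edge (π x) (π y) := by
    intro x y hxy
    obtain ⟨hx, hy⟩ := G.edge_mem x y hxy
    by_cases hxu : x ∈ ({u, v} : Set V)
    · have huy := (hedge_uv x hxu y).1 hxy
      rw [hπ1 x hxu, hπ2 y (hout y huy)]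
      exact (hedgeOut y (hout y huy)).2 huy
    · rw [hπ2 x hxu]
      by_cases hyu : y ∈ ({u, v} : Set V)
      · rw [hπ1 y hyu, hedgeIn x hxu]
        rcases hyu with rfl | rfl
        · exact Or.inl hxy
        · exact Or.inr hxy
      · rw [hπ2 y hyu]
        exact (hedge x y (hnot x hxu (hne' x hx)) (hnot y hyu (hne' y hy))).2 hxy
  have hback : ∀ x ∈ G.nodes, ∀ y', G'.edge (π x) y' → ∃ y, G.edge x y ∧ π y = y' := by
    intro x hx y' hxy
    have hy' := hG'mem y' (G'.edge_mem _ _ hxy).2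
    by_cases hxu : x ∈ ({u, v} : Set V)
    · rw [hπ1 x hxu] at hxy
      exact ⟨y', (hedge_uv x hxu y').2 ((hedgeOut y' hy').1 hxy), hπ2 y' hy'⟩
    · rw [hπ2 x hxu] at hxy
      by_cases hyv : y' = v'
      · subst hyv
        rcases (hedgeIn x hxu).1 hxy with h | h
        · exact ⟨u, h, hπ1 u (Or.inl rfl)⟩
        · exact ⟨v, h, hπ1 v (Or.inr rfl)⟩
      · exact ⟨y', (hedge x y' (hnot x hxu (hne' x hx)) (hnot y' hy' hyv)).1 hxy, hπ2 y' hy'⟩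
  have hG' : G'.Proper := by
    intro x hx
    obtain ⟨x, hxG, rfl⟩ : ∃ z ∈ G.nodes, π z = x := by
      rw [hnodes] at hx
      rcases hx with hx | rfl
      · exact ⟨x, hx.1, hπ2 x hx.2⟩
      · exact ⟨u, hu, hπ1 u (Or.inl rfl)⟩
    obtain ⟨y, hy⟩ := hG x hxG
    exact ⟨π y, hforth x y hy⟩
  have hlift : ∀ (i : Fin 2) (w : V), G'.WinsFrom i (π w) → G.WinsFrom i w := fun i w =>
    ParityGame.winsFrom_of_map π hmem hown hpri hforth hback
  have hv'mem : v' ∈ G'.nodes := hπ1 u (Or.inl rfl) ▸ hmem u hu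
  constructor
  · obtain ⟨i, hi⟩ := hG'.exists_winsFrom hv'mem
    exact ⟨i, ⟨hu, hlift i u (by rwa [hπ1 u (Or.inl rfl)])⟩,
      ⟨hv, hlift i v (by rwa [hπ1 v (Or.inr rfl)])⟩, hv'mem, hi⟩
  · rintro w ⟨hw, hwu⟩ i
    have hw' : w ∈ G'.nodes := hπ2 w hwu ▸ hmem w hw
    have hlift_w : ∀ j, G'.WinsFrom j w → G.WinsFrom j w := fun j hj =>
      hlift j w (by rwa [hπ2 w hwu])
    refine ⟨fun h => ⟨hw', ?_⟩, fun h => ⟨hw, hlift_w i h.2⟩⟩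
    obtain ⟨j, hj⟩ := hG'.exists_winsFrom hw'
    rwa [ParityGame.winsFrom_unique hw h.2 (hlift_w j hj)]
end

section
/- Let c₁' > 0 and c' > 0 be real constants and let T : ℕ → ℝ be nonnegative and satisfy: T(ℓ) ≤ c' · ℓ^{⌊√(2ℓ)⌋} for all ℓ ≤ 4, and T(k) ≤ 2 c₁' (2k)^{⌊√(2k)⌋} · k^{⌊√(2k)⌋} · T(⌊√(2k)⌋) for all k ≥ 5. Then there exist constants c₁ ≥ c' and c₂ ≥ 1 such that T(k) ≤ c₁ · k^{c₂ ⌊√(2k)⌋} for all k ≥ 1. -/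
theorem toNat_floor_sqrt_two_mul (k : ℕ) :
    (⌊Real.sqrt (2 * (k : ℝ))⌋).toNat = Nat.sqrt (2 * k) := by
  have h := Real.floor_real_sqrt_eq_nat_sqrt (a := 2 * k)
  push_cast at h
  rw [h, Int.toNat_natCast]

theorem sqrt_two_mul_pow_five_le {k : ℕ} (hk : 5 ≤ k) : Nat.sqrt (2 * k) ^ 5 ≤ k ^ 4 := by
  have hs : Nat.sqrt (2 * k) ^ 2 ≤ 2 * k := Nat.sqrt_le' _
  refine (Nat.pow_le_pow_iff_left two_ne_zero).mp ?_
  calc (Nat.sqrt (2 * k) ^ 5) ^ 2 = (Nat.sqrt (2 * k) ^ 2) ^ 5 := by ring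
    _ ≤ (2 * k) ^ 5 := Nat.pow_le_pow_left hs 5
    _ = 32 * k ^ 5 := by ring
    _ ≤ 5 ^ 3 * k ^ 5 := by gcongr; norm_num
    _ ≤ k ^ 3 * k ^ 5 := by gcongr
    _ = (k ^ 4) ^ 2 := by ring

theorem recurrence_step_le {k s r M : ℕ} (hk : 2 ≤ k) (hs : 1 ≤ s) (hrs : r ≤ s)
    (hsk : s ^ 5 ≤ k ^ 4) :
    2 ^ M * (2 * k) ^ s * k ^ s * s ^ (5 * (M + 3) * r) ≤ k ^ (5 * (M + 3) * s) := by
  have hM : 2 ^ M ≤ k ^ (M * s) :=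
    (Nat.pow_le_pow_left hk M).trans
      (Nat.pow_le_pow_right (by omega) (Nat.le_mul_of_pos_right M hs))
  have h2 : (2 * k) ^ s ≤ k ^ (2 * s) := by
    rw [pow_mul]
    exact Nat.pow_le_pow_left (by nlinarith) s
  have hr : s ^ (5 * (M + 3) * r) ≤ k ^ (4 * ((M + 3) * s)) :=
    calc s ^ (5 * (M + 3) * r) ≤ s ^ (5 * ((M + 3) * s)) :=
          Nat.pow_le_pow_right hs (by rw [mul_assoc]; gcongr)
      _ = (s ^ 5) ^ ((M + 3) * s) := pow_mul ..
      _ ≤ (k ^ 4) ^ ((M + 3) * s) := Nat.pow_le_pow_left hsk _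
      _ = k ^ (4 * ((M + 3) * s)) := (pow_mul ..).symm
  calc 2 ^ M * (2 * k) ^ s * k ^ s * s ^ (5 * (M + 3) * r)
      ≤ k ^ (M * s) * k ^ (2 * s) * k ^ s * k ^ (4 * ((M + 3) * s)) := by gcongr
    _ = k ^ (5 * (M + 3) * s) := by
        rw [← pow_add, ← pow_add, ← pow_add]
        congr 1
        ring


universe u

/-- Resolving the recurrence for bipartite parity games: if
`T(ℓ) ≤ c'·ℓ^{⌊√(2ℓ)⌋}` for `ℓ ≤ 4`, and
`T(k) ≤ 2c₁'(2k)^{⌊√(2k)⌋}·k^{⌊√(2k)⌋}·T(⌊√(2k)⌋)` for `k ≥ 5`, then there are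
constants `c₁ ≥ c'` and `c₂ ≥ 1` with `T(k) ≤ c₁·k^{c₂⌊√(2k)⌋}` for all `k ≥ 1`. -/
theorem resolve_recurrence_bipartite (c₁' c' : ℝ) (hc₁' : 0 < c₁') (hc' : 0 < c')
    (T : ℕ → ℝ) (hpos : ∀ k, 0 ≤ T k)
    (hbase : ∀ l, l ≤ 4 →
      T l ≤ c' * ((l ^ (⌊Real.sqrt (2 * (l : ℝ))⌋).toNat : ℕ) : ℝ))
    (hrec : ∀ k, 5 ≤ k →
      T k ≤ 2 * c₁' * (((2 * k) ^ (⌊Real.sqrt (2 * (k : ℝ))⌋).toNat : ℕ) : ℝ)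
        * ((k ^ (⌊Real.sqrt (2 * (k : ℝ))⌋).toNat : ℕ) : ℝ)
        * T (⌊Real.sqrt (2 * (k : ℝ))⌋).toNat) :
    ∃ (c₁ : ℝ) (c₂ : ℕ), c' ≤ c₁ ∧ 1 ≤ c₂ ∧
      ∀ k, 1 ≤ k →
        T k ≤ c₁ * ((k ^ (c₂ * (⌊Real.sqrt (2 * (k : ℝ))⌋).toNat) : ℕ) : ℝ) := by
  simp only [toNat_floor_sqrt_two_mul] at hbase hrec ⊢
  obtain ⟨M, hM⟩ := pow_unbounded_of_one_lt (2 * c₁') (one_lt_two (α := ℝ))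
  refine ⟨c', 5 * (M + 3), le_rfl, by omega, fun k => ?_⟩
  induction k using Nat.strong_induction_on with
  | _ k ih =>
    intro hk
    rcases Nat.lt_or_ge k 5 with hk5 | hk5
    · refine (hbase k (by omega)).trans ?_
      gcongr
      exact Nat.le_mul_of_pos_left _ (by omega)
    · have hstep := hrec k hk5
      have hpow := sqrt_two_mul_pow_five_le hk5
      have hs3 : 3 ≤ Nat.sqrt (2 * k) := Nat.le_sqrt.mpr (by omega)
      have hsk : Nat.sqrt (2 * k) < k := Nat.sqrt_lt.mpr (by nlinarith)
      set s := Nat.sqrt (2 * k)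
      have hrs : Nat.sqrt (2 * s) ≤ s :=
        Nat.lt_succ_iff.mp (Nat.sqrt_lt.mpr (by nlinarith))
      have hT := ih s hsk (by omega)
      have hle : ((2 ^ M * (2 * k) ^ s * k ^ s * s ^ (5 * (M + 3) * Nat.sqrt (2 * s)) : ℕ) : ℝ)
          ≤ ((k ^ (5 * (M + 3) * s) : ℕ) : ℝ) :=
        Nat.cast_le.mpr (recurrence_step_le (by omega) (by omega) hrs hpow)
      calc T k ≤ _ := hstep
        _ ≤ 2 ^ M * (((2 * k) ^ s : ℕ) : ℝ) * ((k ^ s : ℕ) : ℝ)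
            * (c' * ((s ^ (5 * (M + 3) * Nat.sqrt (2 * s)) : ℕ) : ℝ)) := by
          gcongr
          exact hpos s
        _ = c' * ((2 ^ M * (2 * k) ^ s * k ^ s * s ^ (5 * (M + 3) * Nat.sqrt (2 * s)) : ℕ) : ℝ) := by
          push_cast
          ring
        _ ≤ c' * ((k ^ (5 * (M + 3) * s) : ℕ) : ℝ) := by gcongr
end
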